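/- arXiv:1206.2227 — 6 statements merged into one kernel-verified Lean document; each statement's English description precedes it below -/
import Mathlib

section
/- For every (e,r) ∈ ℝ² with e > r²/2, the infimum over β > 0 and λ ∈ ℝ of the quantity λr + βe + log Z(β,λ), where Z(β,λ) = (2π/β)·exp(λ²/(2β)), equals 1 + log(2π) + log(e − r²/2), and the infimum is attained at (β,λ) = Ψ(e,r) = (1/(e − r²/2), −r/(e − r²/2)). -/
open Real

/-- The entropy functional, after expanding the logarithm and completing the square in `lam`. -/
lemma entropy_functional_eq (e r lam : ℝ) {β : ℝ} (hβ : 0 < β) :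
    lam * r + β * e + Real.log ((2 * π / β) * Real.exp (lam ^ 2 / (2 * β))) =
      Real.log (2 * π) - Real.log β + β * (e - r ^ 2 / 2) + (lam + β * r) ^ 2 / (2 * β) := by
  have hπ : 2 * π ≠ 0 := by positivity
  rw [Real.log_mul (div_ne_zero hπ hβ.ne') (Real.exp_ne_zero _), Real.log_exp,
    Real.log_div hπ hβ.ne']
  field_simp
  ring

/-- For `(e,r)` with `e > r²/2`, the infimum over `β > 0`, `λ ∈ ℝ`
of `λr + βe + log Z(β,λ)`, with `Z(β,λ) = (2π/β)·exp(λ²/(2β))`, equals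
`1 + log(2π) + log(e − r²/2)`; moreover the infimum is attained at
`(β,λ) = Ψ(e,r) = (1/(e − r²/2), −r/(e − r²/2))`.
`IsLeast` asserts both that the value is a lower bound of the set of values and
that it belongs to it (attainedness). -/
theorem thermodynamic_entropy_inf (e r : ℝ) (h : r ^ 2 / 2 < e) :
    IsLeast {v : ℝ | ∃ β lam : ℝ, 0 < β ∧
        v = lam * r + β * e + Real.log ((2 * π / β) * Real.exp (lam ^ 2 / (2 * β)))}
      (1 + Real.log (2 * π) + Real.log (e - r ^ 2 / 2)) ∧
    ((-r / (e - r ^ 2 / 2)) * r + (1 / (e - r ^ 2 / 2)) * e +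
        Real.log ((2 * π / (1 / (e - r ^ 2 / 2))) *
          Real.exp ((-r / (e - r ^ 2 / 2)) ^ 2 / (2 * (1 / (e - r ^ 2 / 2))))))
      = 1 + Real.log (2 * π) + Real.log (e - r ^ 2 / 2) := by
  have hd : 0 < e - r ^ 2 / 2 := sub_pos.mpr h
  have hattained : ((-r / (e - r ^ 2 / 2)) * r + (1 / (e - r ^ 2 / 2)) * e +
        Real.log ((2 * π / (1 / (e - r ^ 2 / 2))) *
          Real.exp ((-r / (e - r ^ 2 / 2)) ^ 2 / (2 * (1 / (e - r ^ 2 / 2))))))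
      = 1 + Real.log (2 * π) + Real.log (e - r ^ 2 / 2) := by
    rw [entropy_functional_eq e r _ (one_div_pos.mpr hd), one_div_mul_cancel hd.ne', one_div,
      Real.log_inv]
    ring
  refine ⟨⟨⟨_, _, one_div_pos.mpr hd, hattained.symm⟩, ?_⟩, hattained⟩
  rintro v ⟨β, lam, hβ, rfl⟩
  rw [entropy_functional_eq e r lam hβ]
  have hlog := Real.log_le_sub_one_of_pos (mul_pos hβ hd)
  rw [Real.log_mul hβ.ne' hd.ne'] at hlog
  have hsq : 0 ≤ (lam + β * r) ^ 2 / (2 * β) := by positivity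
  linarith
end

section
/- For every β > 0 and λ ∈ ℝ, log Z(β,λ) = sup { S(e,r) − βe − λr : (e,r) ∈ ℝ², e > r²/2 }, where Z(β,λ) = (2π/β)·exp(λ²/(2β)) and S(e,r) = 1 + log(2π) + log(e − r²/2); moreover the supremum is attained exactly at (e,r) = (1/β + λ²/(2β²), −λ/β). -/
open Real

/-- The gap between `log Z(β,λ)` and `S(e,r) − βe − λr` splits into the gap in
`log x ≤ x - 1` at `x = β(e − r²/2)` and a square. -/
theorem logZ_sub_entropy (β lam e r : ℝ) (hβ : 0 < β) (he : r ^ 2 / 2 < e) :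
    Real.log ((2 * π / β) * Real.exp (lam ^ 2 / (2 * β))) -
        ((1 + Real.log (2 * π) + Real.log (e - r ^ 2 / 2)) - β * e - lam * r) =
      (β * (e - r ^ 2 / 2) - 1 - Real.log (β * (e - r ^ 2 / 2))) +
        β / 2 * (r + lam / β) ^ 2 := by
  have hu : 0 < e - r ^ 2 / 2 := sub_pos.2 he
  rw [Real.log_mul (by positivity) (Real.exp_ne_zero _), Real.log_exp,
    Real.log_div (by positivity) hβ.ne', Real.log_mul hβ.ne' hu.ne']
  field_simp
  ring

/-- The supremum is attained exactly at `(1/β + λ²/(2β²), −λ/β)`. -/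
theorem entropy_eq_logZ_iff (β lam e r : ℝ) (hβ : 0 < β) (he : r ^ 2 / 2 < e) :
    (1 + Real.log (2 * π) + Real.log (e - r ^ 2 / 2)) - β * e - lam * r =
        Real.log ((2 * π / β) * Real.exp (lam ^ 2 / (2 * β))) ↔
      e = 1 / β + lam ^ 2 / (2 * β ^ 2) ∧ r = -lam / β := by
  have hx : 0 < β * (e - r ^ 2 / 2) := mul_pos hβ (sub_pos.2 he)
  have hlog := Real.log_le_sub_one_of_pos hx
  have hsq : 0 ≤ β / 2 * (r + lam / β) ^ 2 := by positivity
  rw [eq_comm, ← sub_eq_zero, logZ_sub_entropy β lam e r hβ he,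
    add_eq_zero_iff_of_nonneg (sub_nonneg.2 hlog) hsq]
  constructor
  · rintro ⟨h1, h2⟩
    have hx1 : β * (e - r ^ 2 / 2) = 1 := by
      by_contra hne
      linarith [Real.log_lt_sub_one_of_pos hx hne]
    have hr : r = -lam / β := by
      have h3 : r + lam / β = 0 := by simpa [hβ.ne'] using h2
      rw [neg_div]
      linarith
    refine ⟨?_, hr⟩
    have h4 : e - r ^ 2 / 2 = 1 / β := by rwa [eq_div_iff hβ.ne', mul_comm]
    rw [← h4, hr]
    field_simp
    ring
  · rintro ⟨rfl, rfl⟩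
    have hx1 : β * (1 / β + lam ^ 2 / (2 * β ^ 2) - (-lam / β) ^ 2 / 2) = 1 := by
      field_simp
      ring
    rw [hx1]
    constructor
    · simp
    · rw [neg_div, neg_add_cancel]
      simp

/-- For every `β > 0` and `λ ∈ ℝ`,
`log Z(β,λ) = sup { S(e,r) − βe − λr : e > r²/2 }`, where
`Z(β,λ) = (2π/β)·exp(λ²/(2β))` and `S(e,r) = 1 + log(2π) + log(e − r²/2)`;
the supremum is attained exactly at `(e,r) = (1/β + λ²/(2β²), −λ/β)`.
`IsGreatest` asserts both attainedness and the upper bound property; the second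
conjunct asserts that the supremum is attained *only* at that point. -/
theorem logZ_legendre_of_entropy (β lam : ℝ) (hβ : 0 < β) :
    IsGreatest {v : ℝ | ∃ e r : ℝ, r ^ 2 / 2 < e ∧
        v = (1 + Real.log (2 * π) + Real.log (e - r ^ 2 / 2)) - β * e - lam * r}
      (Real.log ((2 * π / β) * Real.exp (lam ^ 2 / (2 * β)))) ∧
    (∀ e r : ℝ, r ^ 2 / 2 < e →
      ((1 + Real.log (2 * π) + Real.log (e - r ^ 2 / 2)) - β * e - lam * r =
          Real.log ((2 * π / β) * Real.exp (lam ^ 2 / (2 * β))) ↔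
        e = 1 / β + lam ^ 2 / (2 * β ^ 2) ∧ r = -lam / β)) := by
  refine ⟨⟨⟨1 / β + lam ^ 2 / (2 * β ^ 2), -lam / β, ?_⟩, ?_⟩,
    fun e r he => entropy_eq_logZ_iff β lam e r hβ he⟩
  · have he : (-lam / β) ^ 2 / 2 < 1 / β + lam ^ 2 / (2 * β ^ 2) := by
      have h : (-lam / β) ^ 2 / 2 = lam ^ 2 / (2 * β ^ 2) := by
        field_simp
      rw [h]
      exact lt_add_of_pos_left _ (by positivity)
    exact ⟨he, ((entropy_eq_logZ_iff β lam _ _ hβ he).2 ⟨rfl, rfl⟩).symm⟩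
  · rintro v ⟨e, r, he, rfl⟩
    have hlog := Real.log_le_sub_one_of_pos (mul_pos hβ (sub_pos.2 he))
    have hsq : 0 ≤ β / 2 * (r + lam / β) ^ 2 := by positivity
    linarith [logZ_sub_entropy β lam e r hβ he]
end

section
/- Fix an integer N ≥ 3, γ > 0, and work on the configuration space Ω = (ℝ×ℝ)^{ℤ/Nℤ} with coordinates (r_x, p_x), x ∈ ℤ/Nℤ. Define the Liouville operator (A f)(r,p) = Σ_x [(p_{x+1} − p_x) ∂_{r_x} f + (r_x − r_{x−1}) ∂_{p_x} f], the flip operator (S f)(r,p) = (1/2) Σ_x [f(r, p^x) − f(r,p)] where p^x flips the sign of p_x, and L* = −A + γS. Then for every x ∈ ℤ/Nℤ, with f_x(r,p) = −p_{x+1}/γ, the deformation current satisfies the fluctuation–dissipation identity p_{x+1} = (−r_{x+1}/γ) − (−r_x/γ) + (L* f_x)(r,p), as an identity of smooth functions on Ω. -/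
open Finset

/-- Configuration space of the velocity-flip chain on the discrete torus `ℤ/Nℤ`:
a pair `ω = (r, p)` of families indexed by `ZMod N`. -/
abbrev VFConfig (N : ℕ) := (ZMod N → ℝ) × (ZMod N → ℝ)

/-- The Liouville operator
`(A f)(r,p) = Σ_x [(p_{x+1} − p_x) ∂_{r_x} f + (r_x − r_{x−1}) ∂_{p_x} f]`. -/
noncomputable def liouvilleOp (N : ℕ) [NeZero N] (f : VFConfig N → ℝ) :
    VFConfig N → ℝ := fun ω =>
  ∑ x : ZMod N,
    ((ω.2 (x + 1) - ω.2 x) * fderiv ℝ f ω (Pi.single x 1, 0) +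
      (ω.1 x - ω.1 (x - 1)) * fderiv ℝ f ω (0, Pi.single x 1))

/-- The flip operator `(S f)(r,p) = (1/2) Σ_x [f(r, p^x) − f(r,p)]`, where `p^x`
flips the sign of `p_x`. -/
noncomputable def flipOp (N : ℕ) [NeZero N] (f : VFConfig N → ℝ) :
    VFConfig N → ℝ := fun ω =>
  (1 / 2) * ∑ x : ZMod N, (f (ω.1, Function.update ω.2 x (-ω.2 x)) - f ω)

/-- The adjoint generator `L* = −A + γ S`. -/
noncomputable def adjointGen (N : ℕ) [NeZero N] (γ : ℝ) (f : VFConfig N → ℝ) :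
    VFConfig N → ℝ := fun ω =>
  -liouvilleOp N f ω + γ * flipOp N f ω

theorem fderiv_neg_momentum_div (N : ℕ) [NeZero N] (γ : ℝ) (y : ZMod N)
    (ω v : VFConfig N) :
    fderiv ℝ (fun ω' : VFConfig N => -ω'.2 y / γ) ω v = -v.2 y / γ := by
  have h : HasFDerivAt (fun ω' : VFConfig N => -ω'.2 y * γ⁻¹)
      (γ⁻¹ • -(ContinuousLinearMap.proj (R := ℝ) (φ := fun _ : ZMod N => ℝ) y).comp
        (ContinuousLinearMap.snd ℝ (ZMod N → ℝ) (ZMod N → ℝ))) ω :=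
    ((ContinuousLinearMap.proj (R := ℝ) (φ := fun _ : ZMod N => ℝ) y).comp
      (ContinuousLinearMap.snd ℝ (ZMod N → ℝ) (ZMod N → ℝ))).hasFDerivAt.neg.mul_const γ⁻¹
  simp only [div_eq_mul_inv]
  rw [h.fderiv]
  simp [mul_comm]

theorem liouvilleOp_neg_momentum_div (N : ℕ) [NeZero N] (γ : ℝ) (y : ZMod N)
    (ω : VFConfig N) :
    liouvilleOp N (fun ω' => -ω'.2 y / γ) ω = -(ω.1 y - ω.1 (y - 1)) / γ := by
  simp only [liouvilleOp, fderiv_neg_momentum_div]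
  rw [Finset.sum_eq_single y]
  · rw [Pi.single_eq_same]
    simp only [Pi.zero_apply]
    ring
  · intro z _ hz
    simp [Pi.single_eq_of_ne hz.symm]
  · simp

theorem flipOp_neg_momentum_div (N : ℕ) [NeZero N] (γ : ℝ) (y : ZMod N)
    (ω : VFConfig N) :
    flipOp N (fun ω' => -ω'.2 y / γ) ω = ω.2 y / γ := by
  simp only [flipOp]
  rw [Finset.sum_eq_single y]
  · rw [Function.update_self]
    ring
  · intro z _ hz
    simp [Function.update_of_ne hz.symm]
  · simp

/-- fluctuation–dissipation identity for the deformation current: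
with `f_x(r,p) = −p_{x+1}/γ`, for every configuration `ω`,
`p_{x+1} = (−r_{x+1}/γ) − (−r_x/γ) + (L* f_x)(ω)`. -/
theorem fluctuation_dissipation_deformation (N : ℕ) [NeZero N] (hN : 3 ≤ N)
    (γ : ℝ) (hγ : 0 < γ) (x : ZMod N) (ω : VFConfig N) :
    ω.2 (x + 1) =
      (-ω.1 (x + 1) / γ) - (-ω.1 x / γ) +
        adjointGen N γ (fun ω' => -ω'.2 (x + 1) / γ) ω := by
  rw [adjointGen, liouvilleOp_neg_momentum_div, flipOp_neg_momentum_div,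
    add_sub_cancel_right]
  field_simp
  ring
end

section
/- Fix an integer N ≥ 3, γ > 0, and work on Ω = (ℝ×ℝ)^{ℤ/Nℤ} with the operators A, S, and L* = −A + γS as defined for the velocity-flip chain. Then for every x ∈ ℤ/Nℤ, with g_x(r,p) = −(r_x/(2γ))(p_{x+1} + p_x + (γ/2) r_x), the energy current satisfies the fluctuation–dissipation identity p_{x+1} r_x = [−(p_{x+1}² + r_{x+1} r_x)/(2γ)] − [−(p_x² + r_x r_{x−1})/(2γ)] + (L* g_x)(r,p), as an identity of smooth functions on Ω. -/
open Finset

/-- Derivative of the corrector `g_x` in the direction `v`. -/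
lemma fderiv_corrector {N : ℕ} [NeZero N] {γ : ℝ} (hγ : γ ≠ 0) (x : ZMod N) (ω v : VFConfig N) :
    fderiv ℝ (fun ω' : VFConfig N =>
      -(ω'.1 x / (2 * γ)) * (ω'.2 (x + 1) + ω'.2 x + (γ / 2) * ω'.1 x)) ω v =
      -(1 / (2 * γ)) * (v.1 x * (ω.2 (x + 1) + ω.2 x + γ * ω.1 x) +
        ω.1 x * (v.2 (x + 1) + v.2 x)) := by
  have hr : HasFDerivAt (fun ω' : VFConfig N => ω'.1 x)
      ((ContinuousLinearMap.proj x).comp (ContinuousLinearMap.fst ℝ _ _)) ω :=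
    ((ContinuousLinearMap.proj (R := ℝ) (φ := fun _ : ZMod N => ℝ) x).comp
      (ContinuousLinearMap.fst ℝ (ZMod N → ℝ) (ZMod N → ℝ))).hasFDerivAt
  have hp (y : ZMod N) : HasFDerivAt (fun ω' : VFConfig N => ω'.2 y)
      ((ContinuousLinearMap.proj y).comp (ContinuousLinearMap.snd ℝ _ _)) ω :=
    ((ContinuousLinearMap.proj (R := ℝ) (φ := fun _ : ZMod N => ℝ) y).comp
      (ContinuousLinearMap.snd ℝ (ZMod N → ℝ) (ZMod N → ℝ))).hasFDerivAt
  have h := (hr.const_mul (-(1 / (2 * γ)))).mul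
    (((hp (x + 1)).add (hp x)).add (hr.const_mul (γ / 2)))
  have hfun : (fun ω' : VFConfig N =>
      -(ω'.1 x / (2 * γ)) * (ω'.2 (x + 1) + ω'.2 x + (γ / 2) * ω'.1 x)) =
      fun ω' => (-(1 / (2 * γ)) * ω'.1 x) *
        (ω'.2 (x + 1) + ω'.2 x + (γ / 2) * ω'.1 x) := by
    funext ω'
    ring
  rw [hfun]
  refine (congrArg (fun L : VFConfig N →L[ℝ] ℝ => L v) h.fderiv).trans ?_
  simp
  field_simp
  ring

/-- The flips of single momenta change `p_z` only through the flip at `z`. -/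
lemma sum_update_neg_sub {ι : Type*} [Fintype ι] [DecidableEq ι] (p : ι → ℝ) (z : ι) :
    ∑ y, (Function.update p y (-p y) z - p z) = -2 * p z := by
  rw [Finset.sum_eq_single z]
  · simp
    ring
  · intro y _ hy
    simp [Function.update_of_ne hy.symm]
  · simp

lemma liouvilleOp_corrector {N : ℕ} [NeZero N] {γ : ℝ} (hγ : γ ≠ 0) (x : ZMod N)
    (ω : VFConfig N) :
    liouvilleOp N (fun ω' =>
      -(ω'.1 x / (2 * γ)) * (ω'.2 (x + 1) + ω'.2 x + (γ / 2) * ω'.1 x)) ω =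
      -(1 / (2 * γ)) * ((ω.2 (x + 1) - ω.2 x) * (ω.2 (x + 1) + ω.2 x + γ * ω.1 x) +
        ω.1 x * (ω.1 (x + 1) - ω.1 (x - 1))) := by
  have hsum (a : ZMod N → ℝ) (z : ZMod N) :
      ∑ y, a y * (Pi.single y (1 : ℝ) : ZMod N → ℝ) z = a z := by
    simp [Pi.single_apply]
  have hterm (y : ZMod N) :
      (ω.2 (y + 1) - ω.2 y) * (-(1 / (2 * γ)) *
          ((Pi.single y (1 : ℝ) : ZMod N → ℝ) x * (ω.2 (x + 1) + ω.2 x + γ * ω.1 x) +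
            ω.1 x * (0 + 0))) +
        (ω.1 y - ω.1 (y - 1)) * (-(1 / (2 * γ)) *
          (0 * (ω.2 (x + 1) + ω.2 x + γ * ω.1 x) +
            ω.1 x * ((Pi.single y (1 : ℝ) : ZMod N → ℝ) (x + 1) +
              (Pi.single y (1 : ℝ) : ZMod N → ℝ) x))) =
      (-(1 / (2 * γ)) * (ω.2 (x + 1) + ω.2 x + γ * ω.1 x)) *
          ((ω.2 (y + 1) - ω.2 y) * (Pi.single y (1 : ℝ) : ZMod N → ℝ) x) +
        (-(1 / (2 * γ)) * ω.1 x) *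
          ((ω.1 y - ω.1 (y - 1)) * (Pi.single y (1 : ℝ) : ZMod N → ℝ) (x + 1)) +
        (-(1 / (2 * γ)) * ω.1 x) *
          ((ω.1 y - ω.1 (y - 1)) * (Pi.single y (1 : ℝ) : ZMod N → ℝ) x) := by
    ring
  simp only [liouvilleOp, fderiv_corrector hγ, Pi.zero_apply, hterm, Finset.sum_add_distrib,
    ← Finset.mul_sum]
  rw [hsum (fun y => ω.2 (y + 1) - ω.2 y), hsum (fun y => ω.1 y - ω.1 (y - 1)),
    hsum (fun y => ω.1 y - ω.1 (y - 1)), add_sub_cancel_right]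
  ring

lemma flipOp_corrector {N : ℕ} [NeZero N] (γ : ℝ) (x : ZMod N) (ω : VFConfig N) :
    flipOp N (fun ω' =>
      -(ω'.1 x / (2 * γ)) * (ω'.2 (x + 1) + ω'.2 x + (γ / 2) * ω'.1 x)) ω =
      ω.1 x / (2 * γ) * (ω.2 (x + 1) + ω.2 x) := by
  have hterm (y : ZMod N) :
      -(ω.1 x / (2 * γ)) * (Function.update ω.2 y (-ω.2 y) (x + 1) +
          Function.update ω.2 y (-ω.2 y) x + (γ / 2) * ω.1 x) -
        -(ω.1 x / (2 * γ)) * (ω.2 (x + 1) + ω.2 x + (γ / 2) * ω.1 x) =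
      -(ω.1 x / (2 * γ)) * ((Function.update ω.2 y (-ω.2 y) (x + 1) - ω.2 (x + 1)) +
        (Function.update ω.2 y (-ω.2 y) x - ω.2 x)) := by
    ring
  simp only [flipOp, hterm, ← Finset.mul_sum]
  rw [Finset.sum_add_distrib, sum_update_neg_sub, sum_update_neg_sub]
  ring

/-- fluctuation–dissipation identity for the energy current: with
`g_x(r,p) = −(r_x/(2γ))(p_{x+1} + p_x + (γ/2) r_x)`, for every configuration `ω`,
`p_{x+1} r_x = [−(p_{x+1}² + r_{x+1} r_x)/(2γ)] − [−(p_x² + r_x r_{x−1})/(2γ)] + (L* g_x)(ω)`. -/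
theorem fluctuation_dissipation_energy (N : ℕ) [NeZero N] (hN : 3 ≤ N)
    (γ : ℝ) (hγ : 0 < γ) (x : ZMod N) (ω : VFConfig N) :
    ω.2 (x + 1) * ω.1 x =
      (-(ω.2 (x + 1) ^ 2 + ω.1 (x + 1) * ω.1 x) / (2 * γ)) -
        (-(ω.2 x ^ 2 + ω.1 x * ω.1 (x - 1)) / (2 * γ)) +
        adjointGen N γ
          (fun ω' => -(ω'.1 x / (2 * γ)) * (ω'.2 (x + 1) + ω'.2 x + (γ / 2) * ω'.1 x))
          ω := by
  have hγ' : γ ≠ 0 := hγ.ne'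
  rw [adjointGen, liouvilleOp_corrector hγ', flipOp_corrector]
  field_simp
  ring
end

section
/- Let n ≥ 1 and let C be a real symmetric positive semidefinite n × n matrix. Then for every integer k ≥ 1, Σ_{i=1}^n (C_{ii})^k ≤ Tr(C^k). -/
open Finset

theorem Matrix.IsHermitian.pow_apply_self_eq_sum {ι : Type*} [Fintype ι] [DecidableEq ι]
    {A : Matrix ι ι ℝ} (hA : A.IsHermitian) (k : ℕ) (i : ι) :
    (A ^ k) i i = ∑ j, (hA.eigenvectorUnitary : Matrix ι ι ℝ) i j ^ 2 * hA.eigenvalues j ^ k := by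
  conv_lhs => rw [hA.spectral_theorem]
  rw [← map_pow, Matrix.diagonal_pow, Unitary.conjStarAlgAut_apply, Matrix.mul_apply]
  refine Finset.sum_congr rfl fun j _ => ?_
  simp only [Matrix.mul_diagonal, Matrix.star_apply, star_trivial, Pi.pow_apply,
    Function.comp_apply, RCLike.ofReal_real_eq_id, id_eq]
  ring

/-- Jensen's inequality for the spectral measure of `A` at a standard basis vector. -/
theorem Matrix.PosSemidef.apply_self_pow_le_pow_apply_self {ι : Type*} [Fintype ι]
    [DecidableEq ι] {A : Matrix ι ι ℝ} (hA : A.PosSemidef) (k : ℕ) (i : ι) :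
    A i i ^ k ≤ (A ^ k) i i := by
  have h_weights : ∑ j, (hA.isHermitian.eigenvectorUnitary : Matrix ι ι ℝ) i j ^ 2 = 1 := by
    simpa using (hA.isHermitian.pow_apply_self_eq_sum 0 i).symm
  have h_entry := hA.isHermitian.pow_apply_self_eq_sum 1 i
  simp only [pow_one] at h_entry
  rw [h_entry, hA.isHermitian.pow_apply_self_eq_sum k i]
  exact Real.pow_arith_mean_le_arith_mean_pow _ _ _ (fun _ _ => sq_nonneg _) h_weights
    (fun j _ => hA.eigenvalues_nonneg j) k

/-- For a real symmetric positive semidefinite `n × n` matrix `C`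
and every integer `k ≥ 1`, `Σ_i (C_{ii})^k ≤ Tr(C^k)`. -/
theorem diagonal_power_sum_le_trace_pow (n : ℕ) (hn : 1 ≤ n)
    (C : Matrix (Fin n) (Fin n) ℝ) (hC : C.PosSemidef) (k : ℕ) (hk : 1 ≤ k) :
    ∑ i : Fin n, (C i i) ^ k ≤ Matrix.trace (C ^ k) :=
  Finset.sum_le_sum fun i _ => hC.apply_self_pow_le_pow_apply_self k i
end

section
/- Let γ > 0, T > 0, and let e, r : (0,T) × ℝ → ℝ be smooth functions, 1-periodic in q, with e(t,q) > r(t,q)²/2 everywhere, solving ∂_t r = (1/γ) ∂²_q r and ∂_t e = (1/(2γ)) ∂²_q (e + r²/2). Set β(t,q) = 1/(e(t,q) − r(t,q)²/2) and S(e,r) = 1 + log(2π) + log(e − r²/2). Then for every t ∈ (0,T), d/dt ∫₀¹ S(e(t,q), r(t,q)) dq = (1/(2γ)) ∫₀¹ [ (∂_q β(t,q)/β(t,q))² + 2 β(t,q) (∂_q r(t,q))² ] dq ≥ 0. -/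
open Set Real

open MeasureTheory Topology

/-- Differentiation under the integral sign for a function that is `C¹` on an open strip. -/
theorem hasDerivAt_intervalIntegral_of_contDiffOn {U : Set ℝ} (hU : IsOpen U) {F : ℝ → ℝ → ℝ}
    (hF : ContDiffOn ℝ 1 (fun x : ℝ × ℝ => F x.1 x.2) (U ×ˢ univ)) {t : ℝ} (ht : t ∈ U)
    (a b : ℝ) :
    HasDerivAt (fun s => ∫ q in a..b, F s q) (∫ q in a..b, deriv (fun s => F s q) t) t := by
  have hopen : IsOpen (U ×ˢ (univ : Set ℝ)) := hU.prod isOpen_univ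
  set G : ℝ × ℝ → ℝ := fun x => F x.1 x.2 with hG
  have hderiv : ∀ s ∈ U, ∀ q, HasDerivAt (fun s => F s q) (fderiv ℝ G (s, q) (1, 0)) s := by
    intro s hs q
    have h1 : HasFDerivAt G (fderiv ℝ G (s, q)) (s, q) :=
      ((hF.differentiableOn one_ne_zero).differentiableAt
        (hopen.mem_nhds ⟨hs, mem_univ q⟩)).hasFDerivAt
    exact h1.comp_hasDerivAt s ((hasDerivAt_id s).prodMk (hasDerivAt_const s q))
  have hcont : ContinuousOn (fun x : ℝ × ℝ => fderiv ℝ G x (1, 0)) (U ×ˢ univ) :=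
    (hF.continuousOn_fderiv_of_isOpen hopen le_rfl).clm_apply continuousOn_const
  have hslice : ∀ {H : ℝ × ℝ → ℝ}, ContinuousOn H (U ×ˢ univ) → ∀ s ∈ U,
      Continuous fun q => H (s, q) := fun hH s hs =>
    hH.comp_continuous (by fun_prop) fun q => ⟨hs, mem_univ q⟩
  obtain ⟨ε, hε, hball⟩ := Metric.nhds_basis_closedBall.mem_iff.1 (hU.mem_nhds ht)
  obtain ⟨C, hC⟩ := ((isCompact_closedBall t ε).prod (isCompact_uIcc (a := a) (b := b)))
    |>.exists_bound_of_continuousOn (hcont.mono (prod_mono hball (subset_univ _)))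
  have key := intervalIntegral.hasDerivAt_integral_of_dominated_loc_of_deriv_le
    (μ := volume) (a := a) (b := b) (F := F) (F' := fun s q => fderiv ℝ G (s, q) (1, 0))
    (bound := fun _ => C) (Metric.closedBall_mem_nhds t hε)
    (by
      filter_upwards [hU.mem_nhds ht] with s hs
      exact (hslice hF.continuousOn s hs).aestronglyMeasurable)
    ((hslice hF.continuousOn t ht).intervalIntegrable a b)
    (hslice hcont t ht).aestronglyMeasurable
    (.of_forall fun q hq s hs => hC (s, q) ⟨hs, uIoc_subset_uIcc hq⟩)
    intervalIntegrable_const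
    (.of_forall fun q _ s hs => hderiv s (hball hs) q)
  simpa only [fun q => (hderiv t ht q).deriv] using key.2

/-- The derivative of a periodic function is periodic. -/
theorem Function.Periodic.deriv {f : ℝ → ℝ} {c : ℝ} (hf : Function.Periodic f c) :
    Function.Periodic (deriv f) c := fun x => by
  rw [← deriv_comp_add_const, show (fun y => f (y + c)) = f from funext hf]

/-- Over a period, the integrals of `u'' / u` and `(u' / u)²` agree. -/
theorem integral_deriv_deriv_div_eq_of_periodic {u : ℝ → ℝ} (hu : ContDiff ℝ 2 u) {c : ℝ}
    (hper : Function.Periodic u c) (hne : ∀ x, u x ≠ 0) :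
    ∫ x in 0..c, deriv (deriv u) x / u x = ∫ x in 0..c, (deriv u x / u x) ^ 2 := by
  have hu' : ContDiff ℝ 1 (deriv u) := hu.deriv'
  have hc : Continuous u := hu.continuous
  have hc' : Continuous (deriv u) := hu'.continuous
  have hc'' : Continuous (deriv (deriv u)) := hu'.continuous_deriv_one
  have i1 := (hc''.div hc hne).intervalIntegrable (μ := volume)
    (u := fun x => deriv (deriv u) x / u x) 0 c
  have i2 := ((hc'.div hc hne).pow 2).intervalIntegrable (μ := volume)
    (u := fun x => (deriv u x / u x) ^ 2) 0 c
  have hd : ∀ x, HasDerivAt (fun y => deriv u y / u y)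
      (deriv (deriv u) x / u x - (deriv u x / u x) ^ 2) x := fun x => by
    have h := (hu'.differentiable one_ne_zero x).hasDerivAt.fun_div
      (hu.differentiable two_ne_zero x).hasDerivAt (hne x)
    refine h.congr_deriv ?_
    have := hne x
    field_simp
  have h := intervalIntegral.integral_eq_sub_of_hasDerivAt (fun x _ => hd x) (i1.sub i2)
  rw [intervalIntegral.integral_sub i1 i2] at h
  have e1 := hper.deriv 0
  have e2 := hper 0
  rw [zero_add] at e1 e2
  rw [e1, e2, sub_self] at h
  exact sub_eq_zero.1 h

/-- entropy production along the hydrodynamic evolution. If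
`(e, r)` is a smooth 1-periodic-in-`q` solution on `(0,T) × ℝ` of
`∂_t r = (1/γ) ∂²_q r`, `∂_t e = (1/(2γ)) ∂²_q(e + r²/2)` with `e > r²/2`,
and `β = (e − r²/2)⁻¹`, `S(e,r) = 1 + log(2π) + log(e − r²/2)`, then for every
`t ∈ (0,T)`,
`d/dt ∫₀¹ S(e(t,q), r(t,q)) dq
  = (1/(2γ)) ∫₀¹ (∂_q β/β)² + 2β(∂_q r)² dq ≥ 0`. -/
theorem entropy_production_nonneg (γ T : ℝ) (hγ : 0 < γ) (hT : 0 < T)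
    (e r : ℝ → ℝ → ℝ)
    (he_smooth : ContDiffOn ℝ (⊤ : ℕ∞) (fun x : ℝ × ℝ => e x.1 x.2) (Ioo 0 T ×ˢ univ))
    (hr_smooth : ContDiffOn ℝ (⊤ : ℕ∞) (fun x : ℝ × ℝ => r x.1 x.2) (Ioo 0 T ×ˢ univ))
    (he_per : ∀ t q : ℝ, e t (q + 1) = e t q)
    (hr_per : ∀ t q : ℝ, r t (q + 1) = r t q)
    (hpos : ∀ t ∈ Ioo 0 T, ∀ q : ℝ, (r t q) ^ 2 / 2 < e t q)
    (hr_pde : ∀ t ∈ Ioo 0 T, ∀ q : ℝ,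
      deriv (fun s => r s q) t = (1 / γ) * deriv (deriv (fun y => r t y)) q)
    (he_pde : ∀ t ∈ Ioo 0 T, ∀ q : ℝ,
      deriv (fun s => e s q) t =
        (1 / (2 * γ)) * deriv (deriv (fun y => e t y + (r t y) ^ 2 / 2)) q) :
    ∀ t ∈ Ioo 0 T,
      HasDerivAt
        (fun s => ∫ q in (0:ℝ)..1,
          (1 + Real.log (2 * π) + Real.log (e s q - (r s q) ^ 2 / 2)))
        ((1 / (2 * γ)) * ∫ q in (0:ℝ)..1,
          ((deriv (fun y => (e t y - (r t y) ^ 2 / 2)⁻¹) q /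
              (e t q - (r t q) ^ 2 / 2)⁻¹) ^ 2 +
            2 * (e t q - (r t q) ^ 2 / 2)⁻¹ * (deriv (fun y => r t y) q) ^ 2))
        t ∧
      0 ≤ (1 / (2 * γ)) * ∫ q in (0:ℝ)..1,
          ((deriv (fun y => (e t y - (r t y) ^ 2 / 2)⁻¹) q /
              (e t q - (r t q) ^ 2 / 2)⁻¹) ^ 2 +
            2 * (e t q - (r t q) ^ 2 / 2)⁻¹ * (deriv (fun y => r t y) q) ^ 2) := by
  intro t ht
  have he : ContDiff ℝ 2 fun y => e t y :=
    ((he_smooth.of_le (WithTop.coe_le_coe.2 (le_top : (2 : ℕ∞) ≤ ⊤))).comp_contDiff (f := fun y : ℝ => (t, y))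
      (by fun_prop) fun y => ⟨ht, mem_univ y⟩)
  have hr : ContDiff ℝ 2 fun y => r t y :=
    ((hr_smooth.of_le (WithTop.coe_le_coe.2 (le_top : (2 : ℕ∞) ≤ ⊤))).comp_contDiff (f := fun y : ℝ => (t, y))
      (by fun_prop) fun y => ⟨ht, mem_univ y⟩)
  set u : ℝ → ℝ := fun y => e t y - (r t y) ^ 2 / 2 with hu_def
  have hu : ContDiff ℝ 2 u := by fun_prop
  have hupos : ∀ q, 0 < u q := fun q => sub_pos.2 (hpos t ht q)
  have hune : ∀ q, u q ≠ 0 := fun q => (hupos q).ne'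
  have huper : Function.Periodic u 1 := fun q => by simp only [hu_def, he_per, hr_per]
  have hlog : ContDiffOn ℝ 1 (fun x : ℝ × ℝ =>
      1 + Real.log (2 * π) + Real.log (e x.1 x.2 - (r x.1 x.2) ^ 2 / 2)) (Ioo 0 T ×ˢ univ) := by
    have he1 := he_smooth.of_le (m := 1) (by exact_mod_cast (le_top : (1 : ℕ∞) ≤ ⊤))
    have hr1 := hr_smooth.of_le (m := 1) (by exact_mod_cast (le_top : (1 : ℕ∞) ≤ ⊤))
    exact contDiffOn_const.add ((he1.sub ((hr1.pow 2).div_const 2)).log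
      fun x hx => (sub_pos.2 (hpos x.1 hx.1 x.2)).ne')
  have hderiv : ∀ q, deriv (fun s => 1 + Real.log (2 * π) +
      Real.log (e s q - (r s q) ^ 2 / 2)) t =
      (1 / (2 * γ)) * (deriv (deriv u) q / u q +
        2 * (u q)⁻¹ * (deriv (fun y => r t y) q) ^ 2) := by
    intro q
    have hslice : ∀ {f : ℝ → ℝ → ℝ},
        ContDiffOn ℝ (⊤ : ℕ∞) (fun x : ℝ × ℝ => f x.1 x.2) (Ioo 0 T ×ˢ univ) →
        HasDerivAt (fun s => f s q) (deriv (fun s => f s q) t) t := fun {f} hf => by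
      have h1 : DifferentiableAt ℝ (fun x : ℝ × ℝ => f x.1 x.2) (t, q) :=
        (hf.differentiableOn (by simp)).differentiableAt
          ((isOpen_Ioo.prod isOpen_univ).mem_nhds ⟨ht, mem_univ q⟩)
      exact (h1.comp (f := fun s : ℝ => (s, q)) t (by fun_prop)).hasDerivAt
    have hd := (((hslice he_smooth).sub (((hslice hr_smooth).fun_pow 2).div_const 2)).log
      (hune q)).const_add (1 + Real.log (2 * π))
    refine hd.deriv.trans ?_
    have hr' : Differentiable ℝ (deriv fun y => r t y) :=
      (hr.deriv' (n := 1)).differentiable one_ne_zero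
    have hu' : Differentiable ℝ (deriv u) := (hu.deriv' (n := 1)).differentiable one_ne_zero
    have hr0 : Differentiable ℝ fun y => r t y := hr.differentiable two_ne_zero
    have hsplit : (fun y => e t y + (r t y) ^ 2 / 2) = fun y => u y + (r t y) ^ 2 := by
      funext y
      simp only [hu_def]
      ring
    have hfirst : deriv (fun y => u y + (r t y) ^ 2) =
        fun y => deriv u y + 2 * r t y * deriv (fun y => r t y) y := by
      funext y
      have h := (hu.differentiable two_ne_zero y).hasDerivAt.fun_add
        ((hr0 y).hasDerivAt.fun_pow 2)
      rw [h.deriv]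
      simp
    have hsecond : deriv (deriv fun y => u y + (r t y) ^ 2) q = deriv (deriv u) q +
        (2 * (deriv (fun y => r t y) q) ^ 2 + 2 * r t q * deriv (deriv fun y => r t y) q) := by
      rw [hfirst]
      have h := (hu' q).hasDerivAt.fun_add
        (((hr0 q).hasDerivAt.const_mul 2).fun_mul (hr' q).hasDerivAt)
      rw [h.deriv]
      ring
    rw [he_pde t ht q, hr_pde t ht q, hsplit, hsecond]
    have h0 := hune q
    change _ / u q = _
    field_simp
    ring
  have hβ : ∀ q, (deriv (fun y => (u y)⁻¹) q / (u q)⁻¹) ^ 2 = (deriv u q / u q) ^ 2 := by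
    intro q
    have h0 := hune q
    rw [((hu.differentiable two_ne_zero q).hasDerivAt.fun_inv h0).deriv]
    field_simp
  have hβ_nonneg : ∀ q, 0 ≤ (deriv (fun y => (u y)⁻¹) q / (u q)⁻¹) ^ 2 +
      2 * (u q)⁻¹ * (deriv (fun y => r t y) q) ^ 2 := fun q => by
    have := hupos q
    positivity
  refine ⟨?_, mul_nonneg (by positivity)
    (intervalIntegral.integral_nonneg zero_le_one fun q _ => hβ_nonneg q)⟩
  convert hasDerivAt_intervalIntegral_of_contDiffOn isOpen_Ioo
    (F := fun s q => 1 + Real.log (2 * π) + Real.log (e s q - (r s q) ^ 2 / 2))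
    hlog ht 0 1 using 1
  have hcu : Continuous u := hu.continuous
  have hcu' : Continuous (deriv u) := hu.continuous_deriv one_le_two
  have hcu'' : Continuous (deriv (deriv u)) := (hu.deriv' (n := 1)).continuous_deriv_one
  have hcr' : Continuous (deriv fun y => r t y) := hr.continuous_deriv one_le_two
  have i1 := (hcu''.div hcu hune).intervalIntegrable (μ := volume)
    (u := fun q => deriv (deriv u) q / u q) 0 1
  have i2 := ((hcu'.div hcu hune).pow 2).intervalIntegrable (μ := volume)
    (u := fun q => (deriv u q / u q) ^ 2) 0 1
  have i3 := ((continuous_const.mul (hcu.inv₀ hune)).mul (hcr'.pow 2)).intervalIntegrable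
    (μ := volume) (u := fun q => 2 * (u q)⁻¹ * (deriv (fun y => r t y) q) ^ 2) 0 1
  simp only [hderiv]
  change (1 / (2 * γ)) * ∫ q in (0 : ℝ)..1, ((deriv (fun y => (u y)⁻¹) q / (u q)⁻¹) ^ 2 +
      2 * (u q)⁻¹ * (deriv (fun y => r t y) q) ^ 2) = _
  simp only [hβ]
  rw [intervalIntegral.integral_const_mul, intervalIntegral.integral_add i1 i3,
    intervalIntegral.integral_add i2 i3, integral_deriv_deriv_div_eq_of_periodic hu huper hune]
end
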